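/- Fix x₀ ∈ ℝ³ and let F(y) := x₀ − |y|^{−2} y for y ≠ 0, with Jacobian matrix DF(y). Let Ω̃ ⊂ ℝ³ \ {0} be open, Ω := F(Ω̃), ω ∈ ℝ, and let σ, μ : Ω → ℝ be continuous and H, E : Ω → ℂ³ be C¹. Define the pullbacks F*H(y) := (DF(y))ᵀ H(F(y)) and F*E(y) := (DF(y))ᵀ E(F(y)). Then (curl E = iω μ H and curl H = σ E hold at every point of Ω) if and only if (curl(F*E)(y) = iω |y|^{−2} μ(F(y)) (F*H)(y) and curl(F*H)(y) = |y|^{−2} σ(F(y)) (F*E)(y) hold at every point y of Ω̃). -/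

import Mathlib

noncomputable section

/-- Partial derivative `∂ⱼ f` of a complex-valued function on `ℝ³`. -/
def pdC (j : Fin 3) (f : (Fin 3 → ℝ) → ℂ) (x : Fin 3 → ℝ) : ℂ :=
  fderiv ℝ f x (Pi.single j 1)

/-- The curl of a vector field `X : ℝ³ → ℂ³` (zero-based indices). -/
def curl3 (X : (Fin 3 → ℝ) → (Fin 3 → ℂ)) (x : Fin 3 → ℝ) : Fin 3 → ℂ :=
  ![pdC 1 (fun z => X z 2) x - pdC 2 (fun z => X z 1) x,
    pdC 2 (fun z => X z 0) x - pdC 0 (fun z => X z 2) x,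
    pdC 0 (fun z => X z 1) x - pdC 1 (fun z => X z 0) x]

/-- Squared Euclidean norm on `ℝ³`. -/
def normSq3 (y : Fin 3 → ℝ) : ℝ := ∑ j, y j ^ 2

/-- The map `F(y) = x₀ − |y|⁻² y` (Kelvin transform composed with point reflection). -/
def kelvinF (x₀ : Fin 3 → ℝ) (y : Fin 3 → ℝ) : Fin 3 → ℝ :=
  x₀ - (normSq3 y)⁻¹ • y

/-- The pullback `F*X(y) = (DF(y))ᵀ X(F(y))` of a vector field `X : ℝ³ → ℂ³` along
`F : ℝ³ → ℝ³`, where `DF(y)` is the Jacobian matrix of `F` at `y`. -/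
def pullback3 (F : (Fin 3 → ℝ) → (Fin 3 → ℝ)) (X : (Fin 3 → ℝ) → (Fin 3 → ℂ))
    (y : Fin 3 → ℝ) : Fin 3 → ℂ :=
  fun i => ∑ j, ((fderiv ℝ F y (Pi.single i 1) j : ℝ) : ℂ) * X (F y) j

/-- The explicit Jacobian entries of the Kelvin map. -/
def kJ (y : Fin 3 → ℝ) (i j : Fin 3) : ℝ :=
  -((normSq3 y)⁻¹ * (Pi.single i (1:ℝ) : Fin 3 → ℝ) j) + 2 * (normSq3 y)⁻¹ ^ 2 * y i * y j

/-- The explicit second derivatives. -/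
def kJ2 (y : Fin 3 → ℝ) (k i j : Fin 3) : ℝ :=
  2 * (normSq3 y)⁻¹ ^ 2 * y k * (Pi.single i (1:ℝ) : Fin 3 → ℝ) j
   - 8 * (normSq3 y)⁻¹ ^ 3 * y k * y i * y j
   + 2 * (normSq3 y)⁻¹ ^ 2 * ((Pi.single k (1:ℝ) : Fin 3 → ℝ) i * y j
      + (Pi.single k (1:ℝ) : Fin 3 → ℝ) j * y i)

lemma normSq3_pos {y : Fin 3 → ℝ} (hy : y ≠ 0) : 0 < normSq3 y := by
  obtain ⟨j, hj⟩ := Function.ne_iff.1 hy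
  exact Finset.sum_pos' (fun i _ => sq_nonneg _) ⟨j, Finset.mem_univ _, by
    have : y j ≠ 0 := hj
    positivity⟩

lemma hasFDerivAt_coord (y : Fin 3 → ℝ) (i : Fin 3) :
    HasFDerivAt (fun z : Fin 3 → ℝ => z i)
      (ContinuousLinearMap.proj i : (Fin 3 → ℝ) →L[ℝ] ℝ) y :=
  (ContinuousLinearMap.proj i : (Fin 3 → ℝ) →L[ℝ] ℝ).hasFDerivAt

lemma hasFDerivAt_invNormSq {y : Fin 3 → ℝ} (hy : y ≠ 0) :
    ∃ L : (Fin 3 → ℝ) →L[ℝ] ℝ, HasFDerivAt (fun z => (normSq3 z)⁻¹) L y ∧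
      ∀ k, L (Pi.single k 1) = - (2 * (normSq3 y)⁻¹ ^ 2 * y k) := by
  have h1 : HasFDerivAt normSq3
      (∑ j, (2 * y j) • (ContinuousLinearMap.proj j : (Fin 3 → ℝ) →L[ℝ] ℝ)) y := by
    unfold normSq3
    apply HasFDerivAt.fun_sum
    intro j _
    simpa using (hasFDerivAt_coord y j).pow 2
  refine ⟨_, (hasDerivAt_inv (normSq3_pos hy).ne').comp_hasFDerivAt y h1, ?_⟩
  intro k
  fin_cases k <;> simp [Fin.sum_univ_three, Pi.single_apply] <;> ring

lemma kelvin_hasFDerivAt (x₀ : Fin 3 → ℝ) {y : Fin 3 → ℝ} (hy : y ≠ 0) :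
    ∃ L : (Fin 3 → ℝ) →L[ℝ] (Fin 3 → ℝ), HasFDerivAt (kelvinF x₀) L y ∧
      ∀ i j, L (Pi.single i 1) j = kJ y i j := by
  obtain ⟨L, hL, hk⟩ := hasFDerivAt_invNormSq hy
  refine ⟨_, (hasFDerivAt_const x₀ y).sub (hL.smul (hasFDerivAt_id y)), ?_⟩
  intro i j
  simp [hk, kJ]
  ring

lemma kJ_hasFDerivAt {y : Fin 3 → ℝ} (hy : y ≠ 0) (i j : Fin 3) :
    ∃ L : (Fin 3 → ℝ) →L[ℝ] ℝ, HasFDerivAt (fun z => kJ z i j) L y ∧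
      ∀ k, L (Pi.single k 1) = kJ2 y k i j := by
  obtain ⟨L, hL, hk⟩ := hasFDerivAt_invNormSq hy
  unfold kJ
  refine ⟨_, ((hL.mul_const _).neg).add ((((hL.pow 2).const_mul 2).mul
    (hasFDerivAt_coord y i)).mul (hasFDerivAt_coord y j)), ?_⟩
  intro k
  simp [hk, kJ2]
  ring

lemma kJ2_symm (y : Fin 3 → ℝ) (k i j : Fin 3) : kJ2 y k i j = kJ2 y i k j := by
  unfold kJ2
  have : (Pi.single k (1:ℝ) : Fin 3 → ℝ) i = (Pi.single i (1:ℝ) : Fin 3 → ℝ) k := by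
    simp [Pi.single_apply, eq_comm]
  rw [this]; ring

lemma pullback_eq (x₀ : Fin 3 → ℝ) (X : (Fin 3 → ℝ) → (Fin 3 → ℂ)) {y : Fin 3 → ℝ}
    (hy : y ≠ 0) (i : Fin 3) :
    pullback3 (kelvinF x₀) X y i = ∑ j, (kJ y i j : ℂ) * X (kelvinF x₀ y) j := by
  obtain ⟨L, hL, h⟩ := kelvin_hasFDerivAt x₀ hy
  simp only [pullback3, hL.fderiv, h]

lemma clm_expand (A : (Fin 3 → ℝ) →L[ℝ] ℂ) (v : Fin 3 → ℝ) :
    A v = ∑ l, (v l : ℂ) * A (Pi.single l 1) := by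
  conv_lhs => rw [pi_eq_sum_univ' v]
  simp [Pi.single_apply]

lemma pd_pullback (x₀ : Fin 3 → ℝ) (X : (Fin 3 → ℝ) → (Fin 3 → ℂ)) {y : Fin 3 → ℝ}
    (hy : y ≠ 0) (hX : DifferentiableAt ℝ X (kelvinF x₀ y)) (k i : Fin 3) :
    pdC k (fun z => pullback3 (kelvinF x₀) X z i) y =
      ∑ j, ((kJ2 y k i j : ℂ) * X (kelvinF x₀ y) j +
        (kJ y i j : ℂ) * ∑ l, (kJ y k l : ℂ) * pdC l (fun z => X z j) (kelvinF x₀ y)) := by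
  have hev : (fun z => pullback3 (kelvinF x₀) X z i) =ᶠ[nhds y]
      (fun z => ∑ j, (kJ z i j : ℂ) * X (kelvinF x₀ z) j) := by
    filter_upwards [isOpen_ne.mem_nhds hy] with z hz
    exact pullback_eq x₀ X hz i
  obtain ⟨L, hL, h⟩ := kelvin_hasFDerivAt x₀ hy
  choose M hM hMk using kJ_hasFDerivAt hy i
  have hXj : ∀ j, HasFDerivAt (fun z => X z j) (fderiv ℝ (fun z => X z j) (kelvinF x₀ y))
      (kelvinF x₀ y) := fun j => ((differentiableAt_pi.1 hX) j).hasFDerivAt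
  have key := HasFDerivAt.fun_sum (u := Finset.univ) (fun j _ =>
    ((Complex.ofRealCLM.hasFDerivAt).comp y (hM j)).mul ((hXj j).comp y hL))
  unfold pdC
  rw [hev.fderiv_eq]
  erw [key.fderiv]
  rw [sum_apply]
  refine Finset.sum_congr rfl fun j _ => ?_
  have e := clm_expand (fderiv ℝ (fun z => X z j) (kelvinF x₀ y)) (L (Pi.single k 1))
  simp only [h] at e
  simp [hMk, e]
  ring


lemma kJ_cast (y : Fin 3 → ℝ) (i j : Fin 3) : (kJ y i j : ℂ) =
    -((normSq3 y : ℂ)⁻¹ * if j = i then 1 else 0) + 2 * (normSq3 y : ℂ)⁻¹ ^ 2 * y i * y j := by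
  simp only [kJ, Pi.single_apply]
  split_ifs <;> push_cast <;> ring

lemma curl_pullback (x₀ : Fin 3 → ℝ) (X : (Fin 3 → ℝ) → (Fin 3 → ℂ)) {y : Fin 3 → ℝ}
    (hy : y ≠ 0) (hX : DifferentiableAt ℝ X (kelvinF x₀ y)) (i : Fin 3) :
    curl3 (pullback3 (kelvinF x₀) X) y i =
      (((normSq3 y)⁻¹ : ℝ) : ℂ) * ∑ j, (kJ y i j : ℂ) * curl3 X (kelvinF x₀ y) j := by
  have ht : (((normSq3 y)⁻¹ : ℝ) : ℂ) * ((y 0 : ℂ)^2 + (y 1 : ℂ)^2 + (y 2 : ℂ)^2) = 1 := by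
    have : (normSq3 y)⁻¹ * (y 0 ^2 + y 1 ^2 + y 2 ^2) = 1 := by
      have h := inv_mul_cancel₀ (normSq3_pos hy).ne'
      rwa [show normSq3 y = y 0 ^2 + y 1 ^2 + y 2 ^2 by simp [normSq3, Fin.sum_univ_three]] at h ⊢
    exact_mod_cast this
  have s1 := kJ2_symm y 1 2
  have s2 := kJ2_symm y 2 0
  have s3 := kJ2_symm y 0 1
  fin_cases i <;>
  simp only [curl3, Fin.zero_eta, Fin.mk_one, Fin.reduceFinMk, Matrix.cons_val, pd_pullback x₀ X hy hX, Fin.sum_univ_three,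
    s1, s2, s3]
  all_goals
    generalize pdC 0 (fun z => X z 1) (kelvinF x₀ y) = p01
    generalize pdC 0 (fun z => X z 2) (kelvinF x₀ y) = p02
    generalize pdC 1 (fun z => X z 0) (kelvinF x₀ y) = p10
    generalize pdC 1 (fun z => X z 2) (kelvinF x₀ y) = p12
    generalize pdC 2 (fun z => X z 0) (kelvinF x₀ y) = p20
    generalize pdC 2 (fun z => X z 1) (kelvinF x₀ y) = p21
    simp only [kJ_cast, Complex.ofReal_inv, Fin.reduceEq, zero_ne_one, one_ne_zero, if_true, if_false] at ht ⊢
    generalize ((normSq3 y : ℂ))⁻¹ = t at *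
  · linear_combination (-2 * t^2 * (p12 - p21)) * ht
  · linear_combination (-2 * t^2 * (p20 - p02)) * ht
  · linear_combination (-2 * t^2 * (p01 - p10)) * ht

lemma kJ_inj {y : Fin 3 → ℝ} (hy : y ≠ 0) (a b : Fin 3 → ℂ)
    (h : ∀ i, ∑ j, (kJ y i j : ℂ) * a j = ∑ j, (kJ y i j : ℂ) * b j) : ∀ i, a i = b i := by
  have hs : (normSq3 y : ℂ) ≠ 0 := by exact_mod_cast (normSq3_pos hy).ne'
  have hn : (normSq3 y : ℂ) = (y 0 : ℂ)^2 + (y 1 : ℂ)^2 + (y 2 : ℂ)^2 := by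
    simp [normSq3, Fin.sum_univ_three]
  have key : ∀ (c : Fin 3 → ℂ) (i : Fin 3), c i = (normSq3 y : ℂ)^2 *
      ∑ k, (kJ y i k : ℂ) * ∑ j, (kJ y k j : ℂ) * c j := by
    intro c i
    have ht := inv_mul_cancel₀ hs
    generalize hT : ((normSq3 y : ℂ))⁻¹ = t at *
    have ht2 : t * ((y 0 : ℂ)^2 + (y 1 : ℂ)^2 + (y 2 : ℂ)^2) = 1 := by rw [← hn, ht]
    have : ∑ k, (kJ y i k : ℂ) * ∑ j, (kJ y k j : ℂ) * c j = t^2 * c i := by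
      fin_cases i <;> simp only [Fin.sum_univ_three, kJ_cast, hT,
        Fin.zero_eta, Fin.mk_one, Fin.reduceFinMk, Fin.reduceEq, zero_ne_one, one_ne_zero,
        if_true, if_false]
      · linear_combination (4 * t^3 * y 0 * (y 0 * c 0 + y 1 * c 1 + y 2 * c 2)) * ht2
      · linear_combination (4 * t^3 * y 1 * (y 0 * c 0 + y 1 * c 1 + y 2 * c 2)) * ht2
      · linear_combination (4 * t^3 * y 2 * (y 0 * c 0 + y 1 * c 1 + y 2 * c 2)) * ht2
    rw [this]
    linear_combination (-(t * normSq3 y + 1) * c i) * ht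
  intro i
  rw [key a, key b]
  simp only [h]

/-- The inverse of the Kelvin map. -/
def kelvinG (x₀ x : Fin 3 → ℝ) : Fin 3 → ℝ := (normSq3 (x₀ - x))⁻¹ • (x₀ - x)

lemma normSq3_smul (c : ℝ) (y : Fin 3 → ℝ) : normSq3 (c • y) = c ^ 2 * normSq3 y := by
  simp [normSq3, Fin.sum_univ_three]; ring

lemma inv_inv_aux {y : Fin 3 → ℝ} (hy : y ≠ 0) :
    (normSq3 ((normSq3 y)⁻¹ • y))⁻¹ • ((normSq3 y)⁻¹ • y) = y := by
  have := (normSq3_pos hy).ne'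
  rw [normSq3_smul, smul_smul]
  have e : ((normSq3 y)⁻¹ ^ 2 * normSq3 y)⁻¹ * (normSq3 y)⁻¹ = 1 := by field_simp
  rw [e, one_smul]

lemma kelvin_image_open (x₀ : Fin 3 → ℝ) {Ω' : Set (Fin 3 → ℝ)}
    (hΩ'open : IsOpen Ω') (hΩ'0 : (0 : Fin 3 → ℝ) ∉ Ω') : IsOpen (kelvinF x₀ '' Ω') := by
  have e : kelvinF x₀ '' Ω' = {x | x ≠ x₀} ∩ kelvinG x₀ ⁻¹' Ω' := by
    ext x
    constructor
    · rintro ⟨y, hy, rfl⟩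
      have hy0 : y ≠ 0 := fun h => hΩ'0 (h ▸ hy)
      have hs := (normSq3_pos hy0).ne'
      refine ⟨?_, ?_⟩
      · simp [kelvinF, hs, hy0]
      · simpa [kelvinG, kelvinF, inv_inv_aux hy0] using hy
    · rintro ⟨hx, hG⟩
      refine ⟨_, hG, ?_⟩
      have h0 : x₀ - x ≠ 0 := sub_ne_zero.2 (Ne.symm hx)
      simp [kelvinF, kelvinG, inv_inv_aux h0]
  rw [e]
  refine ContinuousOn.isOpen_inter_preimage ?_ isOpen_ne hΩ'open
  unfold kelvinG
  have hc : Continuous fun x => normSq3 (x₀ - x) := by unfold normSq3; fun_prop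
  refine ContinuousOn.smul (hc.continuousOn.inv₀ ?_) (by fun_prop)
  intro x hx
  exact (normSq3_pos (sub_ne_zero.2 (Ne.symm hx))).ne'

/-- Maxwell's equations `curl E = iωμH`, `curl H = σE` on `Ω = F(Ω̃)` hold iff the
pulled-back fields satisfy `curl(F*E) = iω|y|⁻² (μ∘F) F*H`,
`curl(F*H) = |y|⁻² (σ∘F) F*E` on `Ω̃`, where `F(y) = x₀ − |y|⁻² y`. -/
theorem maxwell_kelvin_pullback (x₀ : Fin 3 → ℝ) (Ω' : Set (Fin 3 → ℝ))
    (hΩ'open : IsOpen Ω') (hΩ'0 : (0 : Fin 3 → ℝ) ∉ Ω') (ω : ℝ)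
    (σ μ : (Fin 3 → ℝ) → ℝ)
    (hσ : ContinuousOn σ (kelvinF x₀ '' Ω')) (hμ : ContinuousOn μ (kelvinF x₀ '' Ω'))
    (HH EE : (Fin 3 → ℝ) → (Fin 3 → ℂ))
    (hHH : ContDiffOn ℝ 1 HH (kelvinF x₀ '' Ω')) (hEE : ContDiffOn ℝ 1 EE (kelvinF x₀ '' Ω')) :
    (∀ x ∈ kelvinF x₀ '' Ω', ∀ i : Fin 3,
        curl3 EE x i = Complex.I * (ω : ℂ) * (μ x : ℂ) * HH x i ∧
        curl3 HH x i = (σ x : ℂ) * EE x i)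
    ↔ (∀ y ∈ Ω', ∀ i : Fin 3,
        curl3 (pullback3 (kelvinF x₀) EE) y i
          = Complex.I * (ω : ℂ) * (((normSq3 y)⁻¹ * μ (kelvinF x₀ y) : ℝ) : ℂ) *
              pullback3 (kelvinF x₀) HH y i ∧
        curl3 (pullback3 (kelvinF x₀) HH) y i
          = (((normSq3 y)⁻¹ * σ (kelvinF x₀ y) : ℝ) : ℂ) *
              pullback3 (kelvinF x₀) EE y i) := by
  have hopen := kelvin_image_open x₀ hΩ'open hΩ'0
  have h0 : ∀ y ∈ Ω', y ≠ 0 := fun y hy h => hΩ'0 (h ▸ hy)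
  have hE : ∀ y ∈ Ω', DifferentiableAt ℝ EE (kelvinF x₀ y) := fun y hy =>
    (hEE.differentiableOn one_ne_zero).differentiableAt (hopen.mem_nhds ⟨y, hy, rfl⟩)
  have hH : ∀ y ∈ Ω', DifferentiableAt ℝ HH (kelvinF x₀ y) := fun y hy =>
    (hHH.differentiableOn one_ne_zero).differentiableAt (hopen.mem_nhds ⟨y, hy, rfl⟩)
  rw [Set.forall_mem_image]
  refine forall₂_congr fun y hy => ?_
  have hy0 := h0 y hy
  have hs : (((normSq3 y)⁻¹ : ℝ) : ℂ) ≠ 0 := by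
    exact_mod_cast inv_ne_zero (normSq3_pos hy0).ne'
  have gen : ∀ (X Y : (Fin 3 → ℝ) → (Fin 3 → ℂ)) (c : ℂ),
      DifferentiableAt ℝ X (kelvinF x₀ y) →
      ((∀ i, curl3 X (kelvinF x₀ y) i = c * Y (kelvinF x₀ y) i) ↔
       (∀ i, curl3 (pullback3 (kelvinF x₀) X) y i =
          (((normSq3 y)⁻¹ : ℝ) : ℂ) * (c * pullback3 (kelvinF x₀) Y y i))) := by
    intro X Y c hX
    have e : ∀ i, c * pullback3 (kelvinF x₀) Y y i =
        ∑ j, (kJ y i j : ℂ) * (c * Y (kelvinF x₀ y) j) := by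
      intro i
      rw [pullback_eq x₀ Y hy0, Finset.mul_sum]
      exact Finset.sum_congr rfl fun j _ => by ring
    simp only [curl_pullback x₀ X hy0 hX, e]
    constructor
    · intro h i
      simp only [h]
    · intro h
      exact kJ_inj hy0 _ _ fun i => mul_left_cancel₀ hs (h i)
  rw [forall_and, forall_and]
  refine and_congr ?_ ?_
  · rw [gen EE HH _ (hE y hy)]
    refine forall_congr' fun i => ?_
    rw [Complex.ofReal_mul]
    constructor <;> intro h <;> rw [h] <;> ring
  · rw [gen HH EE _ (hH y hy)]
    refine forall_congr' fun i => ?_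
    rw [Complex.ofReal_mul]
    constructor <;> intro h <;> rw [h] <;> ring
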